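/- Let λ ∈ (0,1) and c_λ > 0. For all φ, ψ ∈ L¹(ℝ) ∩ BV(ℝ), the functions φ·g_λ[ψ] and g_λ[φ]·ψ are integrable on ℝ and ∫_ℝ φ(x) g_λ[ψ](x) dx = ∫_ℝ g_λ[φ](x) ψ(x) dx. -/

import Mathlib

open MeasureTheory Set Filter
open scoped ENNReal NNReal

/-- The fractional Laplacian `g_λ = -(-∂_x²)^{λ/2}` acting on `φ : ℝ → ℝ`,
defined through the singular integral `c_λ ∫ (φ(x+z) - φ(x)) / |z|^{1+λ} dz`. -/
noncomputable def fracLap (lam clam : ℝ) (φ : ℝ → ℝ) (x : ℝ) : ℝ :=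
  clam * ∫ z : ℝ, (φ (x + z) - φ x) / |z| ^ (1 + lam)

/-- A real function of bounded variation on the line is measurable. -/
theorem BoundedVariationOn.measurable_real {f : ℝ → ℝ} (hf : BoundedVariationOn f univ) :
    Measurable f := by
  obtain ⟨p, q, hp, hq, rfl⟩ :=
    hf.locallyBoundedVariationOn.exists_monotoneOn_sub_monotoneOn
  exact (monotoneOn_univ.1 hp).measurable.sub (monotoneOn_univ.1 hq).measurable

/-- An integrable function on the line has integrable increments. -/
theorem MeasureTheory.Integrable.increment {f : ℝ → ℝ} (hf : Integrable f) (z : ℝ) :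
    Integrable fun x => f (x + z) - f x :=
  (hf.comp_add_right z).sub hf

/-- The integral of the increments of a bounded monotone function over a bounded interval. -/
theorem Monotone.intervalIntegral_increment_le {W : ℝ → ℝ} (hW : Monotone W) {V : ℝ}
    (hV : ∀ x, |W x| ≤ V) {z : ℝ} (hz : 0 ≤ z) (a b : ℝ) :
    ∫ x in a..b, (W (x + z) - W x) ≤ 2 * V * z := by
  have hi : ∀ c d, IntervalIntegrable W volume c d := fun _ _ => hW.intervalIntegrable
  have hshift : IntervalIntegrable (fun x => W (x + z)) volume a b :=
    (hW.comp fun _ _ h => add_le_add_left h z : Monotone fun x => W (x + z)).intervalIntegrable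
  have hbound : ∀ c, |∫ x in c..c + z, W x| ≤ V * z := fun c => by
    simpa [abs_of_nonneg hz] using
      intervalIntegral.norm_integral_le_of_norm_le_const (a := c) (b := c + z) (f := W)
        fun x _ => hV x
  rw [intervalIntegral.integral_sub hshift (hi _ _),
    intervalIntegral.integral_comp_add_right (fun x => W x),
    intervalIntegral.integral_interval_sub_interval_comm' (hi _ _) (hi _ _) (hi _ _)]
  linarith [abs_le.1 (hbound a), abs_le.1 (hbound b)]

/-- The `L¹` modulus of continuity of a function of bounded variation is at most linear. -/
theorem BoundedVariationOn.integral_abs_increment_le {f : ℝ → ℝ}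
    (hf : BoundedVariationOn f univ) (hfi : Integrable f) (z : ℝ) :
    ∫ x, |f (x + z) - f x| ≤ 2 * (eVariationOn f univ).toReal * |z| := by
  wlog hz : 0 ≤ z generalizing z
  · have h := this (-z) (by linarith)
    rw [← integral_add_right_eq_self _ z] at h
    simpa [abs_sub_comm] using h
  rw [abs_of_nonneg hz]
  have hloc := hf.locallyBoundedVariationOn
  set W := variationOnFromTo f univ 0
  have hW : Monotone W := monotoneOn_univ.1 (variationOnFromTo.monotoneOn hloc (mem_univ 0))
  refine le_of_tendsto' (intervalIntegral_tendsto_integral (hfi.increment z).abs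
    (tendsto_neg_atTop_atBot.comp tendsto_natCast_atTop_atTop)
    (tendsto_natCast_atTop_atTop (R := ℝ))) fun n => ?_
  refine le_trans ?_ (hW.intervalIntegral_increment_le
    (fun x => variationOnFromTo.abs_le_eVariationOn hf) hz (-n) n)
  refine intervalIntegral.integral_mono_on (by simp)
    (hfi.increment z).abs.intervalIntegrable
    ((hW.comp fun _ _ h => add_le_add_left h z :
      Monotone fun x => W (x + z)).intervalIntegrable.sub hW.intervalIntegrable) fun x _ => ?_
  exact variationOnFromTo.abs_sub_le_sub_of_le hloc (mem_univ _) (mem_univ _) (mem_univ _)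
    (by linarith)

theorem integral_abs_increment_le_two_mul {f : ℝ → ℝ} (hf : Integrable f) (z : ℝ) :
    ∫ x, |f (x + z) - f x| ≤ 2 * ∫ x, |f x| := by
  calc ∫ x, |f (x + z) - f x| ≤ ∫ x, (|f (x + z)| + |f x|) :=
        integral_mono (hf.increment z).abs ((hf.comp_add_right z).abs.add hf.abs)
          fun x => abs_sub _ _
    _ = 2 * ∫ x, |f x| := by
        rw [integral_add (hf.comp_add_right z).abs hf.abs,
          integral_add_right_eq_self fun x => |f x|, two_mul]

/-- The Lévy kernel of order `lam` integrates `min |z| 1`. -/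
theorem integrable_min_abs_one_div_abs_rpow {lam : ℝ} (h0 : 0 < lam) (h1 : lam < 1) :
    Integrable fun z : ℝ => min |z| 1 / |z| ^ (1 + lam) := by
  set f : ℝ → ℝ := fun z => min |z| 1 / |z| ^ (1 + lam) with hf
  have hnear : IntegrableOn f (Ioc 0 1) := by
    have h : IntegrableOn (fun z : ℝ => z ^ (-lam)) (Ioc 0 1) :=
      (intervalIntegrable_iff_integrableOn_Ioc_of_le zero_le_one).1
        (intervalIntegral.intervalIntegrable_rpow' (by linarith))
    refine h.congr_fun (fun z hz => ?_) measurableSet_Ioc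
    simp only [hf]
    rw [abs_of_pos hz.1, min_eq_left hz.2, Real.rpow_add hz.1, Real.rpow_one,
      Real.rpow_neg hz.1.le, div_mul_cancel_left₀ hz.1.ne']
  have hfar : IntegrableOn f (Ioi 1) := by
    have h : IntegrableOn (fun z : ℝ => z ^ (-(1 + lam))) (Ioi 1) :=
      integrableOn_Ioi_rpow_of_lt (by linarith) one_pos
    refine h.congr_fun (fun z hz => ?_) measurableSet_Ioi
    have hz' : (0 : ℝ) < z := one_pos.trans hz
    simp only [hf]
    rw [abs_of_pos hz', min_eq_right (le_of_lt hz), Real.rpow_neg hz'.le, one_div]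
  have hpos : IntegrableOn f (Ioi 0) := by
    rw [← Ioc_union_Ioi_eq_Ioi zero_le_one]
    exact hnear.union hfar
  have hneg : IntegrableOn f (Iic 0) := by
    rw [← integrableOn_Ici_iff_integrableOn_Ioi] at hpos
    have h := hpos.comp_neg
    simpa [hf] using h
  rw [← integrableOn_univ, ← Iic_union_Ioi (a := (0 : ℝ))]
  exact hneg.union hpos

/-- The double integral defining `∫ φ g_λ[ψ]` converges absolutely. -/
theorem integrable_prod_mul_increment_div {lam : ℝ} (h0 : 0 < lam) (h1 : lam < 1) {φ ψ : ℝ → ℝ}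
    (hφbv : BoundedVariationOn φ univ) {C : ℝ} (hC : ∀ x, |φ x| ≤ C)
    (hψ : Integrable ψ) (hψbv : BoundedVariationOn ψ univ) :
    Integrable (fun p : ℝ × ℝ => φ p.1 * ((ψ (p.1 + p.2) - ψ p.1) / |p.2| ^ (1 + lam)))
      (volume.prod volume) := by
  have hφm := hφbv.measurable_real
  have hψm := hψbv.measurable_real
  have hC0 : 0 ≤ C := (abs_nonneg _).trans (hC 0)
  have hm : Measurable fun p : ℝ × ℝ =>
      φ p.1 * ((ψ (p.1 + p.2) - ψ p.1) / |p.2| ^ (1 + lam)) := by fun_prop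
  have hslice : ∀ z, Integrable fun x => φ x * ((ψ (x + z) - ψ x) / |z| ^ (1 + lam)) := fun z =>
    ((hψ.increment z).div_const _).bdd_mul hφm.aestronglyMeasurable (ae_of_all _ hC)
  rw [integrable_prod_iff' hm.aestronglyMeasurable]
  refine ⟨ae_of_all _ hslice, ?_⟩
  set V := (eVariationOn ψ univ).toReal
  set L := ∫ x, |ψ x|
  refine ((integrable_min_abs_one_div_abs_rpow h0 h1).const_mul (C * (2 * max V L))).mono'
    hm.norm.stronglyMeasurable.integral_prod_left'.aestronglyMeasurable (ae_of_all _ fun z => ?_)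
  have hk : 0 ≤ |z| ^ (1 + lam) := by positivity
  have hmod : ∫ x, |ψ (x + z) - ψ x| ≤ 2 * max V L * min |z| 1 := by
    rcases le_total |z| 1 with h | h
    · rw [min_eq_left h]
      refine (hψbv.integral_abs_increment_le hψ z).trans ?_
      gcongr
      exact le_max_left _ _
    · rw [min_eq_right h, mul_one]
      refine (integral_abs_increment_le_two_mul hψ z).trans ?_
      gcongr
      exact le_max_right _ _
  rw [Real.norm_of_nonneg (integral_nonneg fun _ => norm_nonneg _)]
  calc ∫ x, ‖φ x * ((ψ (x + z) - ψ x) / |z| ^ (1 + lam))‖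
      ≤ ∫ x, C * (|ψ (x + z) - ψ x| / |z| ^ (1 + lam)) := by
        refine integral_mono (hslice z).norm (((hψ.increment z).abs.div_const _).const_mul _)
          fun x => ?_
        simp only [norm_mul, norm_div, Real.norm_eq_abs, abs_of_nonneg hk]
        gcongr
        exact hC x
    _ = C * ((∫ x, |ψ (x + z) - ψ x|) / |z| ^ (1 + lam)) := by
        rw [integral_const_mul, integral_div]
    _ ≤ C * ((2 * max V L * min |z| 1) / |z| ^ (1 + lam)) := by gcongr
    _ = C * (2 * max V L) * (min |z| 1 / |z| ^ (1 + lam)) := by ring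

/-- Discrete summation by parts on the line. -/
theorem integral_mul_increment {φ ψ : ℝ → ℝ} (hφm : Measurable φ) {C : ℝ} (hC : ∀ x, |φ x| ≤ C)
    (hψ : Integrable ψ) (z : ℝ) :
    ∫ x, φ x * (ψ (x + z) - ψ x) = ∫ x, ψ x * (φ (x + -z) - φ x) := by
  have h1 : Integrable fun x => φ x * ψ (x + z) :=
    (hψ.comp_add_right z).bdd_mul hφm.aestronglyMeasurable (ae_of_all _ hC)
  have h2 : Integrable fun x => φ x * ψ x :=
    hψ.bdd_mul hφm.aestronglyMeasurable (ae_of_all _ hC)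
  have h3 : Integrable fun x => φ (x + -z) * ψ x := by simpa using h1.comp_add_right (-z)
  calc ∫ x, φ x * (ψ (x + z) - ψ x) = (∫ x, φ x * ψ (x + z)) - ∫ x, φ x * ψ x := by
        rw [← integral_sub h1 h2]
        simp only [mul_sub]
    _ = (∫ x, φ (x + -z) * ψ x) - ∫ x, φ x * ψ x := by
        rw [← integral_add_right_eq_self _ (-z)]
        simp
    _ = ∫ x, ψ x * (φ (x + -z) - φ x) := by
        rw [← integral_sub h3 h2]
        congr 1 with x
        ring

/-- A function of bounded variation on the line is bounded. -/
theorem BoundedVariationOn.exists_abs_le {f : ℝ → ℝ} (hf : BoundedVariationOn f univ) :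
    ∃ C, ∀ x, |f x| ≤ C := by
  refine ⟨|f 0| + (eVariationOn f univ).toReal, fun x => ?_⟩
  have h := hf.dist_le (mem_univ x) (mem_univ 0)
  rw [Real.dist_eq] at h
  linarith [abs_sub_abs_le_abs_sub (f x) (f 0)]

theorem mul_fracLap_eq_integral (lam clam : ℝ) (φ ψ : ℝ → ℝ) (x : ℝ) :
    φ x * fracLap lam clam ψ x =
      clam * ∫ z, φ x * ((ψ (x + z) - ψ x) / |z| ^ (1 + lam)) := by
  rw [fracLap, integral_const_mul]
  ring

/-- Lemma A.2 (self-adjointness): for `φ, ψ ∈ L¹(ℝ) ∩ BV(ℝ)`, the products `φ·g_λ[ψ]`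
and `g_λ[φ]·ψ` are integrable and `∫ φ g_λ[ψ] = ∫ g_λ[φ] ψ`. -/
theorem stmt_1 (lam clam : ℝ) (hlam : lam ∈ Set.Ioo (0 : ℝ) 1) (hclam : 0 < clam)
    (φ ψ : ℝ → ℝ)
    (hφ : Integrable φ) (hφbv : BoundedVariationOn φ Set.univ)
    (hψ : Integrable ψ) (hψbv : BoundedVariationOn ψ Set.univ) :
    Integrable (fun x => φ x * fracLap lam clam ψ x) ∧
    Integrable (fun x => fracLap lam clam φ x * ψ x) ∧
    ∫ x : ℝ, φ x * fracLap lam clam ψ x = ∫ x : ℝ, fracLap lam clam φ x * ψ x := by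
  obtain ⟨C, hC⟩ := hφbv.exists_abs_le
  obtain ⟨D, hD⟩ := hψbv.exists_abs_le
  have hF := integrable_prod_mul_increment_div hlam.1 hlam.2 hφbv hC hψ hψbv
  have hG := integrable_prod_mul_increment_div hlam.1 hlam.2 hψbv hD hφ hφbv
  simp only [mul_comm (fracLap lam clam φ _), mul_fracLap_eq_integral]
  refine ⟨hF.integral_prod_left.const_mul _, hG.integral_prod_left.const_mul _, ?_⟩
  rw [integral_const_mul, integral_const_mul,
    integral_integral_swap (f := fun x z => φ x * ((ψ (x + z) - ψ x) / |z| ^ (1 + lam))) hF,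
    integral_integral_swap (f := fun x z => ψ x * ((φ (x + z) - φ x) / |z| ^ (1 + lam))) hG,
    ← integral_neg_eq_self]
  simp only [abs_neg, ← mul_div_assoc, integral_div]
  congr 2 with z
  rw [integral_mul_increment hφbv.measurable_real hC hψ, neg_neg]
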